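/- Let 0 < r₀ < r be real numbers and let κ, μ ∈ ℂ with Re(μ) > 0 and Re(μ−κ+1/2) > 0. Then the series (1/(r r₀)^{μ+1/2}) Σ_{ℓ=0}^∞ (−1)^ℓ · ((μ−κ+1/2)_ℓ / ((ℓ+2μ)_ℓ · ℓ!)) · M_{κ,ℓ+μ}(r₀) · W_{κ,ℓ+μ}(r) converges, and its sum equals (r+r₀)^{−μ−1/2} · W_{κ,μ}(r+r₀). Here for complex exponents the powers of the positive reals r r₀ and r + r₀ are taken with their principal values. -/

import Mathlib

open scoped BigOperators
open MeasureTheory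

noncomputable section

/-- Ascending Pochhammer symbol `(a)_n = a (a+1) ⋯ (a+n-1)`. -/
def aP (n : ℕ) (a : ℂ) : ℂ := (ascPochhammer ℂ n).eval a

/-- The Whittaker function `M_{κ,μ}(r)` for `r > 0`:
`M_{κ,μ}(r) = e^{-r/2} r^{μ+1/2} ∑_n ((μ-κ+1/2)_n / ((2μ+1)_n n!)) r^n`,
with the principal power `r^{μ+1/2}`. -/
def whittakerM (κ μ : ℂ) (r : ℝ) : ℂ :=
  Complex.exp (-(r : ℂ) / 2) * (r : ℂ) ^ (μ + 1 / 2) *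
    ∑' n : ℕ, aP n (μ - κ + 1 / 2) / (aP n (2 * μ + 1) * (n.factorial : ℂ)) * (r : ℂ) ^ n

/-- The Whittaker function `W_{κ,μ}(r)` for `r > 0`, `Re(μ-κ+1/2) > 0`, defined by the integral
representation `W_{κ,μ}(r) = e^{-r/2} r^κ Γ(μ-κ+1/2)⁻¹ ∫_0^∞ t^{μ-κ-1/2} (1+t/r)^{μ+κ-1/2} e^{-t} dt`. -/
def whittakerW (κ μ : ℂ) (r : ℝ) : ℂ :=
  Complex.exp (-(r : ℂ) / 2) * (r : ℂ) ^ κ * (Complex.Gamma (μ - κ + 1 / 2))⁻¹ *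
    ∫ t in Set.Ioi (0 : ℝ),
      (t : ℂ) ^ (μ - κ - 1 / 2) * ((1 + t / r : ℝ) : ℂ) ^ (μ + κ - 1 / 2) * Complex.exp (-(t : ℂ))

@[simp]
lemma aP_zero (a : ℂ) : aP 0 a = 1 := by simp [aP]

lemma aP_succ (n : ℕ) (a : ℂ) : aP (n + 1) a = aP n a * (a + n) :=
  ascPochhammer_succ_eval n a

lemma aP_succ_left (n : ℕ) (a : ℂ) : aP (n + 1) a = a * aP n (a + 1) := by
  simp [aP, ascPochhammer_succ_left, Polynomial.eval_comp]

lemma ne_zero_of_re_pos {a : ℂ} (ha : 0 < a.re) : a ≠ 0 := by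
  rintro rfl
  simp at ha

lemma aP_ne_zero (n : ℕ) {a : ℂ} (ha : 0 < a.re) : aP n a ≠ 0 := by
  induction n with
  | zero => simp
  | succ n ih =>
    rw [aP_succ]
    refine mul_ne_zero ih (ne_zero_of_re_pos ?_)
    simp only [Complex.add_re, Complex.natCast_re]
    positivity

lemma Gamma_mul_aP (n : ℕ) {a : ℂ} (ha : 0 < a.re) :
    Complex.Gamma a * aP n a = Complex.Gamma (a + n) := by
  induction n with
  | zero => simp
  | succ n ih =>
    rw [aP_succ, ← mul_assoc, ih, Nat.cast_succ, ← add_assoc, Complex.Gamma_add_one, mul_comm]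
    refine ne_zero_of_re_pos ?_
    simp only [Complex.add_re, Complex.natCast_re]
    positivity

lemma Gamma_re_add_le_norm_aP (n : ℕ) {a : ℂ} (ha : 0 < a.re) :
    Real.Gamma (a.re + n) ≤ Real.Gamma a.re * ‖aP n a‖ := by
  induction n with
  | zero => simp
  | succ n ih =>
    have hpos : 0 < a.re + n := by positivity
    rw [aP_succ, norm_mul, ← mul_assoc, Nat.cast_succ, ← add_assoc,
      Real.Gamma_add_one hpos.ne', mul_comm]
    refine mul_le_mul ih ?_ hpos.le (by positivity)
    simpa using Complex.re_le_norm (a + n)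

/-- The coefficientwise comparison behind the domination of `₁F₁(a; b; y)` by an exponential. -/
lemma norm_aP_le_mul_norm_aP {a b : ℂ} {C : ℝ} (hC : 0 ≤ C)
    (h : ∀ k : ℕ, ‖a + k‖ ≤ C * ‖b + k‖) (n : ℕ) : ‖aP n a‖ ≤ C ^ n * ‖aP n b‖ := by
  induction n with
  | zero => simp
  | succ n ih =>
    rw [aP_succ, aP_succ, norm_mul, norm_mul, pow_succ]
    calc ‖aP n a‖ * ‖a + n‖ ≤ (C ^ n * ‖aP n b‖) * (C * ‖b + n‖) :=
          mul_le_mul ih (h n) (norm_nonneg _) (by positivity)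
      _ = _ := by ring

/-- A finite connection formula: a three-term recurrence expresses the diagonal
value `u m m` through the values `u i (2 * i)`. -/
lemma sum_antidiagonal_eq_of_recurrence (x b : ℂ) (hb : 1 < b.re) (u : ℕ → ℕ → ℂ)
    (h : ∀ i j, x * u (i + 1) (j + 2) = u i j + (b + j) * u (i + 1) (j + 1)) (m : ℕ) :
    ∑ p ∈ Finset.HasAntidiagonal.antidiagonal m, (-1) ^ p.1 * x ^ p.1 /
        (aP p.1 (p.1 + b - 1) * (p.1.factorial : ℂ) *
          (aP p.2 (b + 2 * p.1) * (p.2.factorial : ℂ))) * u p.1 (2 * p.1)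
      = (-1) ^ m / (m.factorial : ℂ) * u m m := by
  induction m generalizing b u with
  | zero => simp
  | succ m ih =>
    have ih' := ih (b + 1) (by simp; linarith) (fun i j => u (i + 1) (j + 1))
      (fun i j => by
        have := h (i + 1) (j + 1)
        push_cast at this ⊢
        rw [this]; ring)
    set F : ℕ × ℕ → ℂ := fun p => (-1) ^ p.1 * x ^ p.1 /
        (aP p.1 (p.1 + b - 1) * (p.1.factorial : ℂ) *
          (aP p.2 (b + 2 * p.1) * (p.2.factorial : ℂ))) * u p.1 (2 * p.1) with hF
    set A : ℕ × ℕ → ℂ := fun p =>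
      p.1 * (b + 2 * p.1 + p.2 - 1) / ((m + 1) * (b + 2 * p.1 - 1)) * F p with hA
    set B : ℕ × ℕ → ℂ := fun p =>
      p.2 * (b + p.1 - 1) / ((m + 1) * (b + 2 * p.1 - 1)) * F p with hB
    have hm : (m : ℂ) + 1 ≠ 0 := Nat.cast_add_one_ne_zero m
    have hsplit : ∑ p ∈ Finset.HasAntidiagonal.antidiagonal (m + 1), F p =
        ∑ p ∈ Finset.HasAntidiagonal.antidiagonal (m + 1), A p + ∑ p ∈ Finset.HasAntidiagonal.antidiagonal (m + 1), B p := by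
      rw [← Finset.sum_add_distrib]
      refine Finset.sum_congr rfl fun p hp => ?_
      have hp' : (p.1 : ℂ) + p.2 = m + 1 := by
        exact_mod_cast congrArg (Nat.cast (R := ℂ)) (Finset.HasAntidiagonal.mem_antidiagonal.mp hp)
      have hd : b + 2 * p.1 - 1 ≠ 0 := by
        refine ne_zero_of_re_pos ?_
        simp
        have : (0 : ℝ) ≤ p.1 := by positivity
        linarith
      simp only [hA, hB]
      rw [← add_mul, ← add_div]
      have : (p.1 : ℂ) * (b + 2 * p.1 + p.2 - 1) + p.2 * (b + p.1 - 1) =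
          (m + 1) * (b + 2 * p.1 - 1) := by rw [← hp']; ring
      rw [this, div_self (mul_ne_zero hm hd), one_mul]
    rw [hsplit, Finset.Nat.sum_antidiagonal_succ, Finset.Nat.sum_antidiagonal_succ' (f := B)]
    have hA0 : A (0, m + 1) = 0 := by simp [hA]
    have hB0 : B (m + 1, 0) = 0 := by simp [hB]
    rw [hA0, hB0, zero_add, zero_add, ← Finset.sum_add_distrib]
    have hR : (-1 : ℂ) ^ (m + 1) / ((m + 1).factorial : ℂ) * u (m + 1) (m + 1) =
        -(1 / (m + 1)) * ((-1) ^ m / (m.factorial : ℂ) * u (m + 1) (m + 1)) := by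
      rw [Nat.factorial_succ]
      have : (m.factorial : ℂ) ≠ 0 := Nat.cast_ne_zero.mpr m.factorial_ne_zero
      push_cast
      field_simp
      ring
    rw [hR, ← ih', Finset.mul_sum]
    refine Finset.sum_congr rfl fun p hp => ?_
    obtain ⟨i, j⟩ := p
    have hi0 : (0 : ℝ) ≤ i := by positivity
    have hj0 : (0 : ℝ) ≤ j := by positivity
    have n1 : b + 2 * i ≠ 0 := ne_zero_of_re_pos (by simp; linarith)
    have n2 : b + 2 * i + 1 ≠ 0 := ne_zero_of_re_pos (by simp; linarith)
    have n3 : b + 2 * i + 1 + j ≠ 0 := ne_zero_of_re_pos (by simp; linarith)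
    have n4 : b + 2 * i - 1 ≠ 0 := ne_zero_of_re_pos (by simp; linarith)
    have n5 : b + i - 1 ≠ 0 := ne_zero_of_re_pos (by simp; linarith)
    have n6 : aP i (i + b) ≠ 0 := aP_ne_zero _ (by simp; linarith)
    have n7 : aP j (b + 2 * i + 1) ≠ 0 := aP_ne_zero _ (by simp; linarith)
    have hfi : (i.factorial : ℂ) ≠ 0 := Nat.cast_ne_zero.mpr i.factorial_ne_zero
    have hfj : (j.factorial : ℂ) ≠ 0 := Nat.cast_ne_zero.mpr j.factorial_ne_zero
    have hii : (i : ℂ) + 1 ≠ 0 := Nat.cast_add_one_ne_zero i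
    have hjj : (j : ℂ) + 1 ≠ 0 := Nat.cast_add_one_ne_zero j
    have e1 : aP (i + 1) (((i + 1 : ℕ) : ℂ) + b - 1) = aP i (i + b) * (b + 2 * i) := by
      rw [aP_succ]; push_cast; ring_nf
    have e2 : aP j (b + 2 * ((i + 1 : ℕ) : ℂ)) =
        aP j (b + 2 * i + 1) * (b + 2 * i + 1 + j) / (b + 2 * i + 1) := by
      rw [← aP_succ, aP_succ_left]; push_cast
      rw [mul_div_cancel_left₀ _ n2]; ring_nf
    have e3 : aP i (i + b - 1) = (b + i - 1) * aP i (i + b) / (b + 2 * i - 1) := by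
      rw [eq_div_iff n4]
      have t1 := aP_succ i (i + b - 1)
      have t2 := aP_succ_left i (i + b - 1)
      rw [sub_add_cancel] at t2
      rw [t2] at t1
      linear_combination -t1
    have e4 : aP (j + 1) (b + 2 * i) = (b + 2 * i) * aP j (b + 2 * i + 1) := aP_succ_left _ _
    have hu := h i (2 * i)
    simp only [hA, hB, hF]
    rw [e1, e2, e3, e4, Nat.factorial_succ, Nat.factorial_succ]
    rw [show (i : ℂ) + (b + 1) - 1 = i + b by ring, show b + 1 + 2 * (i : ℂ) = b + 2 * i + 1 by ring]
    rw [show 2 * (i + 1) = 2 * i + 2 by ring]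
    push_cast at hu ⊢
    rw [show b + 2 * ((i : ℂ) + 1) + j - 1 = b + 2 * i + 1 + j by ring,
      show b + 2 * ((i : ℂ) + 1) - 1 = b + 2 * i + 1 by ring]
    have hu' : u (i + 1) (2 * i + 1) = (x * u (i + 1) (2 * i + 2) - u i (2 * i)) / (b + 2 * i) := by
      rw [eq_div_iff n1]; linear_combination -hu
    rw [hu', pow_succ, pow_succ]
    clear e1 e2 e3 e4 hu hu'
    generalize aP i (i + b) = P at *
    generalize aP j (b + 2 * i + 1) = Q at *
    generalize b + 2 * (i : ℂ) + 1 + j = w at *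
    generalize b + 2 * (i : ℂ) + 1 = z at *
    generalize b + 2 * (i : ℂ) - 1 = y at *
    generalize b + (i : ℂ) - 1 = v at *
    generalize b + 2 * (i : ℂ) = t at *
    field_simp
    ring

/-- The integrand of `betaLaplace`. -/
def betaLaplaceKernel (α β : ℂ) (x s : ℝ) : ℂ :=
  (s : ℂ) ^ α * ((1 + s : ℝ) : ℂ) ^ β * (Real.exp (-(x * s)) : ℂ)

/-- The Laplace transform `∫_0^∞ s^α (1+s)^β e^{-xs} ds`, that is, the confluent hypergeometric
function `Γ(α+1) U(α+1, α+β+2, x)`. -/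
def betaLaplace (α β : ℂ) (x : ℝ) : ℂ :=
  ∫ s in Set.Ioi (0 : ℝ), betaLaplaceKernel α β x s

lemma norm_betaLaplaceKernel (α β : ℂ) (x : ℝ) {s : ℝ} (hs : 0 < s) :
    ‖betaLaplaceKernel α β x s‖ = s ^ α.re * (1 + s) ^ β.re * Real.exp (-(x * s)) := by
  rw [betaLaplaceKernel, norm_mul, norm_mul, Complex.norm_cpow_eq_rpow_re_of_pos hs,
    Complex.norm_cpow_eq_rpow_re_of_pos (by linarith), Complex.norm_real,
    Real.norm_of_nonneg (Real.exp_pos _).le]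

lemma exists_one_add_rpow_le_exp (c : ℝ) {ε : ℝ} (hε : 0 < ε) :
    ∃ C : ℝ, ∀ s : ℝ, 0 ≤ s → (1 + s) ^ c ≤ C * Real.exp (ε * s) := by
  obtain ⟨N, hN⟩ := exists_nat_ge c
  refine ⟨N.factorial / ε ^ N * Real.exp ε, fun s hs => ?_⟩
  have h1 : (1 + s) ^ c ≤ (1 + s) ^ N := by
    rw [← Real.rpow_natCast]
    exact Real.rpow_le_rpow_of_exponent_le (by linarith) hN
  have h2 := Real.pow_div_factorial_le_exp (x := ε * (1 + s)) (by positivity) N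
  rw [mul_pow, div_le_iff₀ (by positivity)] at h2
  rw [mul_assoc, ← Real.exp_add, show ε + ε * s = ε * (1 + s) by ring]
  refine h1.trans ?_
  rw [div_mul_eq_mul_div, le_div_iff₀ (by positivity)]
  linarith

lemma measurable_betaLaplaceKernel (α β : ℂ) (x : ℝ) :
    Measurable (betaLaplaceKernel α β x) := by
  unfold betaLaplaceKernel
  fun_prop

lemma integrableOn_betaLaplaceKernel {α : ℂ} (β : ℂ) {x : ℝ} (hα : -1 < α.re) (hx : 0 < x) :
    IntegrableOn (betaLaplaceKernel α β x) (Set.Ioi 0) := by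
  obtain ⟨C, hC⟩ := exists_one_add_rpow_le_exp β.re (half_pos hx)
  have hi := (integrableOn_rpow_mul_exp_neg_mul_rpow hα one_pos (half_pos hx)).const_mul C
  refine Integrable.mono' hi (measurable_betaLaplaceKernel α β x).aestronglyMeasurable ?_
  refine (ae_restrict_iff' measurableSet_Ioi).mpr (ae_of_all _ fun s (hs : 0 < s) => ?_)
  rw [norm_betaLaplaceKernel α β x hs, Real.rpow_one]
  have h1 := hC s hs.le
  calc s ^ α.re * (1 + s) ^ β.re * Real.exp (-(x * s))
      ≤ s ^ α.re * (C * Real.exp (x / 2 * s)) * Real.exp (-(x * s)) := by gcongr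
    _ = C * (s ^ α.re * (Real.exp (x / 2 * s) * Real.exp (-(x * s)))) := by ring
    _ = _ := by rw [← Real.exp_add]; ring_nf

lemma betaLaplaceKernel_one_add (α β : ℂ) (x : ℝ) {s : ℝ} (hs : 0 < s) :
    betaLaplaceKernel α (β + 1) x s =
      betaLaplaceKernel α β x s + betaLaplaceKernel (α + 1) β x s := by
  have h0 : (s : ℂ) ≠ 0 := by exact_mod_cast hs.ne'
  have h1 : ((1 + s : ℝ) : ℂ) ≠ 0 := by exact_mod_cast (by positivity : 1 + s ≠ 0)
  simp only [betaLaplaceKernel]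
  rw [Complex.cpow_add _ _ h0, Complex.cpow_add _ _ h1, Complex.cpow_one, Complex.cpow_one]
  push_cast
  ring

lemma tendsto_betaLaplaceKernel_atTop {α : ℂ} (β : ℂ) {x : ℝ} (hα : 0 < α.re) (hx : 0 < x) :
    Filter.Tendsto (betaLaplaceKernel α β x) Filter.atTop (nhds 0) := by
  obtain ⟨C, hC⟩ := exists_one_add_rpow_le_exp (α.re + β.re) (half_pos hx)
  have hlim : Filter.Tendsto (fun s : ℝ => C * Real.exp (-(x / 2 * s))) Filter.atTop (nhds 0) := by
    rw [← mul_zero C]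
    refine (Real.tendsto_exp_neg_atTop_nhds_zero.comp ?_).const_mul C
    exact Filter.tendsto_id.const_mul_atTop (half_pos hx)
  refine squeeze_zero_norm' ?_ hlim
  filter_upwards [Filter.eventually_gt_atTop 0] with s hs
  rw [norm_betaLaplaceKernel α β x hs]
  calc s ^ α.re * (1 + s) ^ β.re * Real.exp (-(x * s))
      ≤ (1 + s) ^ α.re * (1 + s) ^ β.re * Real.exp (-(x * s)) := by gcongr; linarith
    _ = (1 + s) ^ (α.re + β.re) * Real.exp (-(x * s)) := by
        rw [Real.rpow_add (by linarith)]
    _ ≤ C * Real.exp (x / 2 * s) * Real.exp (-(x * s)) := by gcongr; exact hC s hs.le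
    _ = C * Real.exp (-(x / 2 * s)) := by rw [mul_assoc, ← Real.exp_add]; ring_nf

lemma hasDerivAt_betaLaplaceKernel {α β : ℂ} (x : ℝ) {s : ℝ} (hs : 0 < s)
    (hα : α + 1 ≠ 0) :
    HasDerivAt (betaLaplaceKernel (α + 1) (β + 1) x)
      ((α + 1) * betaLaplaceKernel α (β + 1) x s + (β + 1) * betaLaplaceKernel (α + 1) β x s
        - x * betaLaplaceKernel (α + 1) (β + 1) x s) s := by
  have h1 : HasDerivAt (fun s : ℝ => (s : ℂ) ^ (α + 1)) ((α + 1) * (s : ℂ) ^ (α + 1 - 1)) s :=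
    hasDerivAt_ofReal_cpow_const hs.ne' hα
  have h2 : HasDerivAt (fun s : ℝ => ((1 + s : ℝ) : ℂ) ^ (β + 1))
      ((β + 1) * ((1 + s : ℝ) : ℂ) ^ β) s := by
    have hb : HasDerivAt (fun s : ℝ => ((1 + s : ℝ) : ℂ)) 1 s := by
      simpa using ((hasDerivAt_id s).const_add 1).ofReal_comp
    have hm : ((1 + s : ℝ) : ℂ) ∈ Complex.slitPlane :=
      Complex.ofReal_mem_slitPlane.mpr (by linarith)
    have hp := (hasDerivAt_id ((1 + s : ℝ) : ℂ)).cpow_const (c := β + 1) hm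
    simpa [Function.comp_def] using! hp.scomp s hb
  have h3 : HasDerivAt (fun s : ℝ => (Real.exp (-(x * s)) : ℂ))
      (-x * (Real.exp (-(x * s)) : ℂ)) s := by
    have h : HasDerivAt (fun s : ℝ => Real.exp (-(x * s))) (Real.exp (-(x * s)) * -(x * 1)) s :=
      (((hasDerivAt_id s).const_mul x).neg).exp
    convert h.ofReal_comp using 1
    push_cast
    ring
  convert! (h1.mul h2).mul h3 using 1
  simp only [betaLaplaceKernel, add_sub_cancel_right, Pi.mul_apply]
  ring

/-- The contiguous relation `x U(a+1, b+2, x) = U(a, b, x) + b U(a+1, b+1, x)`, in the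
normalization of `betaLaplace`. -/
lemma betaLaplace_recurrence {α : ℂ} (β : ℂ) {x : ℝ} (hα : -1 < α.re) (hx : 0 < x) :
    x * betaLaplace (α + 1) (β + 1) x =
      (α + 1) * betaLaplace α β x + (α + β + 2) * betaLaplace (α + 1) β x := by
  have hα1 : 0 < (α + 1).re := by simp; linarith
  have hα1' : -1 < (α + 1).re := by linarith
  have i0 := integrableOn_betaLaplaceKernel (β + 1) hα hx
  have i1 := integrableOn_betaLaplaceKernel β hα1' hx
  have i2 := integrableOn_betaLaplaceKernel (β + 1) hα1' hx
  have i3 := integrableOn_betaLaplaceKernel β hα hx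
  have hcont : ContinuousWithinAt (betaLaplaceKernel (α + 1) (β + 1) x) (Set.Ici 0) 0 := by
    refine ContinuousAt.continuousWithinAt ?_
    unfold betaLaplaceKernel
    refine ContinuousAt.mul (ContinuousAt.mul ?_ ?_) (by fun_prop)
    · exact Complex.continuousAt_ofReal_cpow_const _ _ (Or.inl hα1)
    · exact ContinuousAt.cpow (by fun_prop) (by fun_prop) (by simp)
  have key := integral_Ioi_of_hasDerivAt_of_tendsto hcont
    (fun s hs => hasDerivAt_betaLaplaceKernel x hs (ne_zero_of_re_pos hα1))
    (((i0.const_mul (α + 1)).add (i1.const_mul (β + 1))).sub (i2.const_mul (x : ℂ)))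
    (tendsto_betaLaplaceKernel_atTop (β + 1) hα1 hx)
  have hsplit : betaLaplace α (β + 1) x = betaLaplace α β x + betaLaplace (α + 1) β x := by
    unfold betaLaplace
    rw [← integral_add i3 i1]
    exact setIntegral_congr_fun measurableSet_Ioi fun s hs => betaLaplaceKernel_one_add α β x hs
  have hzero : betaLaplaceKernel (α + 1) (β + 1) x 0 = 0 := by
    simp [betaLaplaceKernel, Complex.zero_cpow (ne_zero_of_re_pos hα1)]
  have i01 := (i0.const_mul (α + 1)).add (i1.const_mul (β + 1))
  simp only [Pi.add_def] at i01
  rw [integral_sub i01 (i2.const_mul (x : ℂ)),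
    integral_add (i0.const_mul (α + 1)) (i1.const_mul (β + 1)), integral_const_mul,
    integral_const_mul, integral_const_mul, hzero, sub_zero] at key
  change (α + 1) * betaLaplace α (β + 1) x + (β + 1) * betaLaplace (α + 1) β x
    - x * betaLaplace (α + 1) (β + 1) x = 0 at key
  rw [hsplit] at key
  linear_combination -key

/-- The Taylor expansion of `betaLaplace` in its last argument. -/
lemma hasSum_betaLaplace_add {α : ℂ} (β : ℂ) {x y : ℝ} (hα : -1 < α.re) (hy : 0 < y)
    (hxy : y < x) :
    HasSum (fun m : ℕ => (-y : ℂ) ^ m / (m.factorial : ℂ) * betaLaplace (α + m) β x)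
      (betaLaplace α β (x + y)) := by
  have hF : ∀ (m : ℕ) (s : ℝ), 0 < s →
      (-y : ℂ) ^ m / (m.factorial : ℂ) * betaLaplaceKernel (α + m) β x s =
        ((-(y * s) : ℝ) : ℂ) ^ m / (m.factorial : ℂ) * betaLaplaceKernel α β x s := by
    intro m s hs
    have h0 : (s : ℂ) ≠ 0 := by exact_mod_cast hs.ne'
    simp only [betaLaplaceKernel]
    rw [Complex.cpow_add _ _ h0, Complex.cpow_natCast]
    push_cast
    rw [← neg_mul (y : ℂ) (s : ℂ), mul_pow]
    ring
  have hsum : ∀ s : ℝ, HasSum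
      (fun m : ℕ => (y * s) ^ m / (m.factorial : ℝ) * ‖betaLaplaceKernel α β x s‖)
      (Real.exp (y * s) * ‖betaLaplaceKernel α β x s‖) := fun s => by
    have := NormedSpace.expSeries_div_hasSum_exp (y * s)
    rw [← Real.exp_eq_exp_ℝ] at this
    exact this.mul_right _
  have key := hasSum_integral_of_dominated_convergence
    (μ := volume.restrict (Set.Ioi (0 : ℝ)))
    (F := fun (m : ℕ) s => (-y : ℂ) ^ m / (m.factorial : ℂ) * betaLaplaceKernel (α + m) β x s)
    (f := betaLaplaceKernel α β (x + y))
    (fun m s => (y * s) ^ m / (m.factorial : ℝ) * ‖betaLaplaceKernel α β x s‖)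
    (fun m => ((measurable_betaLaplaceKernel (α + m) β x).const_mul _).aestronglyMeasurable)
    ?_ (ae_of_all _ fun s => (hsum s).summable) ?_ ?_
  · simpa only [integral_const_mul] using! key
  · intro m
    refine (ae_restrict_iff' measurableSet_Ioi).mpr (ae_of_all _ fun s (hs : 0 < s) => ?_)
    rw [hF m s hs, norm_mul, norm_div, norm_pow, Complex.norm_real, norm_neg,
      Real.norm_of_nonneg (by positivity : 0 ≤ y * s), Complex.norm_natCast]
  · simp only [(hsum _).tsum_eq]
    refine IntegrableOn.congr_fun
      (integrableOn_betaLaplaceKernel β hα (sub_pos.mpr hxy)).norm ?_ measurableSet_Ioi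
    intro s (hs : 0 < s)
    simp only
    rw [norm_betaLaplaceKernel α β _ hs, norm_betaLaplaceKernel α β _ hs,
      show -((x - y) * s) = y * s + -(x * s) by ring, Real.exp_add]
    ring
  · refine (ae_restrict_iff' measurableSet_Ioi).mpr (ae_of_all _ fun s (hs : 0 < s) => ?_)
    simp only [hF _ s hs]
    have := NormedSpace.expSeries_div_hasSum_exp ((-(y * s) : ℝ) : ℂ)
    rw [← Complex.exp_eq_exp_ℂ] at this
    convert! this.mul_right (betaLaplaceKernel α β x s) using 1
    rw [betaLaplaceKernel, betaLaplaceKernel, show -((x + y) * s) = -(y * s) + -(x * s) by ring,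
      Real.exp_add]
    push_cast
    ring

lemma norm_betaLaplace_le {α β : ℂ} {x : ℝ} (hα : 0 ≤ α.re) (hc : 0 < α.re + β.re + 1)
    (hx : 0 < x) :
    ‖betaLaplace α β x‖ ≤
      Real.exp x * ((1 / x) ^ (α.re + β.re + 1) * Real.Gamma (α.re + β.re + 1)) := by
  set c := α.re + β.re + 1 with hcdef
  set h : ℝ → ℝ := fun u => u ^ (c - 1) * Real.exp (-(x * u)) with hh
  have hh_int : IntegrableOn h (Set.Ioi 0) := by
    have := integrableOn_rpow_mul_exp_neg_mul_rpow (s := c - 1) (by linarith) one_pos hx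
    simpa only [Real.rpow_one, neg_mul] using! this
  have hsub : Set.Ioi (1 : ℝ) ⊆ Set.Ioi 0 := Set.Ioi_subset_Ioi zero_le_one
  have hmp := measurePreserving_add_left (volume : Measure ℝ) 1
  have hemb := measurableEmbedding_addLeft (1 : ℝ)
  have hpre : (fun s : ℝ => 1 + s) ⁻¹' Set.Ioi 1 = Set.Ioi 0 := by
    ext s; simp
  have hint1 : IntegrableOn (fun s => h (1 + s)) (Set.Ioi 0) := by
    rw [← hpre]
    exact (hmp.integrableOn_comp_preimage hemb).mpr (hh_int.mono_set hsub)
  have htrans : ∫ s in Set.Ioi (0 : ℝ), h (1 + s) = ∫ u in Set.Ioi (1 : ℝ), h u := by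
    rw [← hmp.setIntegral_preimage_emb hemb h (Set.Ioi 1), hpre]
  calc ‖betaLaplace α β x‖
      ≤ ∫ s in Set.Ioi (0 : ℝ), Real.exp x * h (1 + s) := by
        refine norm_integral_le_of_norm_le (hint1.const_mul _) ?_
        refine (ae_restrict_iff' measurableSet_Ioi).mpr (ae_of_all _ fun s (hs : 0 < s) => ?_)
        rw [norm_betaLaplaceKernel α β x hs]
        calc s ^ α.re * (1 + s) ^ β.re * Real.exp (-(x * s))
            ≤ (1 + s) ^ α.re * (1 + s) ^ β.re * Real.exp (-(x * s)) := by gcongr; linarith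
          _ = (1 + s) ^ (c - 1) * Real.exp (x + -(x * (1 + s))) := by
            rw [← Real.rpow_add (by linarith)]
            congr 2
            · rw [hcdef]; ring
            · ring
          _ = Real.exp x * h (1 + s) := by rw [Real.exp_add, hh]; ring
    _ = Real.exp x * ∫ u in Set.Ioi (1 : ℝ), h u := by rw [integral_const_mul, htrans]
    _ ≤ Real.exp x * ∫ u in Set.Ioi (0 : ℝ), h u := by
        refine mul_le_mul_of_nonneg_left ?_ (Real.exp_pos x).le
        refine setIntegral_mono_set hh_int ?_ (ae_of_all _ hsub)
        refine (ae_restrict_iff' measurableSet_Ioi).mpr (ae_of_all _ fun s (hs : 0 < s) => ?_)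
        simp only [hh, Pi.zero_apply]
        positivity
    _ = _ := by rw [hh, Real.integral_rpow_mul_exp_neg_mul_Ioi hc hx]

lemma summable_pow_mul_Gamma_div_factorial {c q : ℝ} (hc : 0 < c) (hq0 : 0 < q) (hq : q < 1) :
    Summable fun l : ℕ => q ^ l * (Real.Gamma (l + c) / (l.factorial : ℝ)) := by
  have hpos : ∀ l : ℕ, 0 < q ^ l * (Real.Gamma (l + c) / (l.factorial : ℝ)) := fun l => by
    have : 0 < Real.Gamma (l + c) := Real.Gamma_pos_of_pos (by positivity)
    positivity
  refine summable_of_ratio_test_tendsto_lt_one hq (Filter.Eventually.of_forall fun l => (hpos l).ne')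
    ?_
  have hlim : Filter.Tendsto (fun l : ℕ => q * (1 + (c - 1) * (1 / ((l : ℝ) + 1)))) Filter.atTop
      (nhds (q * (1 + (c - 1) * 0))) :=
    ((tendsto_one_div_add_atTop_nhds_zero_nat.const_mul (c - 1)).const_add 1).const_mul q
  rw [mul_zero, add_zero, mul_one] at hlim
  refine hlim.congr fun l => ?_
  have hG : 0 < Real.Gamma (l + c) := Real.Gamma_pos_of_pos (by positivity)
  have hl : (l : ℝ) + c ≠ 0 := by positivity
  have hf : (l.factorial : ℝ) ≠ 0 := by positivity
  have hl1 : (l : ℝ) + 1 ≠ 0 := by positivity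
  rw [Real.norm_of_nonneg (hpos _).le, Real.norm_of_nonneg (hpos _).le, Nat.factorial_succ]
  push_cast
  rw [show (l : ℝ) + 1 + c = l + c + 1 by ring, Real.Gamma_add_one hl]
  field_simp
  ring

lemma summable_norm_betaLaplace_coeff {α β : ℂ} {x y : ℝ} (hα : -1 < α.re)
    (hc : 0 < (α + β + 1).re) (hy : 0 < y) (hxy : y < x) :
    Summable fun l : ℕ => ‖((x * y : ℝ) : ℂ) ^ l / (aP l (l + (α + β + 1)) * (l.factorial : ℂ)) *
      betaLaplace (α + l) (β + l) x‖ := by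
  have hx : 0 < x := hy.trans hxy
  set c := (α + β + 1).re with hcdef
  have hsum := ((summable_pow_mul_Gamma_div_factorial hc (div_pos hy hx)
    ((div_lt_one hx).mpr hxy)).mul_left (Real.exp x * (1 / x) ^ c))
  rw [← summable_nat_add_iff 1] at hsum ⊢
  refine Summable.of_nonneg_of_le (fun l => norm_nonneg _) (fun k => ?_) hsum
  have hk : (1 : ℝ) ≤ (k + 1 : ℕ) := by exact_mod_cast Nat.succ_pos k
  generalize k + 1 = l at hk ⊢
  have hexp : (α + l).re + (β + l).re + 1 = c + (2 * l : ℕ) := by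
    simp [hcdef]; ring
  have hG := norm_betaLaplace_le (α := α + l) (β := β + l) (x := x) (by simp; linarith)
    (by rw [hexp]; positivity) hx
  rw [hexp, Real.rpow_add (by positivity), Real.rpow_natCast] at hG
  have hre : ((l : ℂ) + (α + β + 1)).re = l + c := by simp [hcdef]
  have hP := Gamma_re_add_le_norm_aP l (a := (l : ℂ) + (α + β + 1)) (by rw [hre]; positivity)
  rw [hre, show (l : ℝ) + c + l = c + (2 * l : ℕ) by push_cast; ring] at hP
  have hGpos : 0 < Real.Gamma (l + c) := Real.Gamma_pos_of_pos (by positivity)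
  have hPpos : 0 < ‖aP l ((l : ℂ) + (α + β + 1))‖ :=
    norm_pos_iff.mpr (aP_ne_zero l (by rw [hre]; positivity))
  rw [norm_mul, norm_div, norm_mul, norm_pow, Complex.norm_real,
    Real.norm_of_nonneg (by positivity : 0 ≤ x * y), Complex.norm_natCast]
  generalize ‖aP l ((l : ℂ) + (α + β + 1))‖ = p at *
  calc (x * y) ^ l / (p * (l.factorial : ℝ)) * ‖betaLaplace (α + l) (β + l) x‖
      ≤ (x * y) ^ l / (p * (l.factorial : ℝ)) * (Real.exp x *
          ((1 / x) ^ c * (1 / x) ^ (2 * l) * (Real.Gamma (l + c) * p))) := by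
        gcongr
        refine hG.trans ?_
        gcongr
    _ = Real.exp x * (1 / x) ^ c * ((y / x) ^ l * (Real.Gamma (l + c) / (l.factorial : ℝ))) := by
        have hpow : (x * y) ^ l * (1 / x) ^ (2 * l) = (y / x) ^ l := by
          rw [pow_mul, ← mul_pow]
          congr 1
          field_simp
        rw [← hpow]
        field_simp

lemma norm_aP_div_mul_pow_le {a b : ℂ} (hb : 1 < b.re) {y : ℝ} (hy : 0 < y) (l n : ℕ) :
    ‖aP n (a + l) / (aP n (b + 2 * l) * (n.factorial : ℂ)) * (y : ℂ) ^ n‖ ≤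
      ((‖a‖ + 1) * y) ^ n / (n.factorial : ℝ) := by
  set C : ℝ := ‖a‖ + 1 with hC
  have hl0 : (0 : ℝ) ≤ l := by positivity
  have hre : 0 < (b + 2 * l).re := by simp; linarith
  have hle : ‖aP n (a + l)‖ ≤ C ^ n * ‖aP n (b + 2 * l)‖ := by
    refine norm_aP_le_mul_norm_aP (by positivity) (fun k => ?_) n
    have hk0 : (0 : ℝ) ≤ k := by positivity
    have hup := norm_add_le a ((l + k : ℕ) : ℂ)
    rw [Complex.norm_natCast] at hup
    push_cast at hup
    rw [← add_assoc] at hup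
    have hlow : 1 + ((l : ℝ) + k) ≤ ‖b + 2 * l + k‖ := by
      refine le_trans ?_ (Complex.re_le_norm _)
      simp
      linarith
    have hmul : C * (1 + ((l : ℝ) + k)) ≤ C * ‖b + 2 * l + k‖ :=
      mul_le_mul_of_nonneg_left hlow (by positivity)
    have hn : 0 ≤ ‖a‖ * ((l : ℝ) + k) := by positivity
    rw [hC] at hmul ⊢
    nlinarith
  have hpos : 0 < ‖aP n (b + 2 * l)‖ := norm_pos_iff.mpr (aP_ne_zero n hre)
  simp only [norm_mul, norm_div, norm_pow, Complex.norm_real, Complex.norm_natCast,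
    Real.norm_of_nonneg hy.le]
  rw [mul_pow, div_mul_eq_mul_div, div_le_div_iff₀ (by positivity) (by positivity)]
  calc ‖aP n (a + l)‖ * y ^ n * (n.factorial : ℝ)
      ≤ (C ^ n * ‖aP n (b + 2 * l)‖) * y ^ n * (n.factorial : ℝ) := by gcongr
    _ = _ := by ring

lemma sum_antidiagonal_betaLaplace {α β : ℂ} {x : ℝ} (y : ℝ) (hα : -1 < α.re)
    (hc : 0 < α.re + β.re + 1) (hx : 0 < x) (m : ℕ) :
    ∑ p ∈ Finset.HasAntidiagonal.antidiagonal m,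
      (-1) ^ p.1 * (((x * y : ℝ) : ℂ) ^ p.1 /
        (aP p.1 (p.1 + (α + β + 1)) * (p.1.factorial : ℂ)) *
          betaLaplace (α + p.1) (β + p.1) x) *
        (aP p.2 (α + 1 + p.1) / (aP p.2 (α + β + 2 + 2 * p.1) * (p.2.factorial : ℂ)) *
          (y : ℂ) ^ p.2) =
      (-y : ℂ) ^ m / (m.factorial : ℂ) * betaLaplace (α + m) β x := by
  have hre : ∀ i : ℕ, 0 < (α + 1 + i).re := fun i => by
    have : (0 : ℝ) ≤ i := by positivity
    simp; linarith
  have hΓ : ∀ i : ℕ, Complex.Gamma (α + 1 + i) ≠ 0 := fun i =>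
    Complex.Gamma_ne_zero_of_re_pos (hre i)
  have hrec : ∀ i j : ℕ,
      x * (betaLaplace (α + (i + 1 : ℕ)) (β + (j + 2 : ℕ) - (i + 1 : ℕ)) x /
        Complex.Gamma (α + 1 + (i + 1 : ℕ))) =
      betaLaplace (α + i) (β + j - i) x / Complex.Gamma (α + 1 + i) +
        (α + β + 2 + j) * (betaLaplace (α + (i + 1 : ℕ)) (β + (j + 1 : ℕ) - (i + 1 : ℕ)) x /
          Complex.Gamma (α + 1 + (i + 1 : ℕ))) := fun i j => by
    have hi0 : (0 : ℝ) ≤ i := by positivity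
    have hrec := betaLaplace_recurrence (α := α + i) (β + j - i) (x := x)
      (by simp; linarith) hx
    have hne : α + 1 + i ≠ 0 := ne_zero_of_re_pos (hre i)
    have hG1 : Complex.Gamma (α + 1 + (i + 1 : ℕ)) =
        (α + 1 + i) * Complex.Gamma (α + 1 + i) := by
      rw [← Complex.Gamma_add_one _ hne]
      push_cast
      ring_nf
    have hΓi := hΓ i
    rw [hG1]
    push_cast
    rw [show β + ((j : ℂ) + 2) - (i + 1) = β + j - i + 1 by ring,
      show β + ((j : ℂ) + 1) - (i + 1) = β + j - i by ring,
      show α + ((i : ℂ) + 1) = α + i + 1 by ring]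
    generalize Complex.Gamma (α + 1 + i) = G at *
    generalize betaLaplace (α + i + 1) (β + j - i + 1) x = B1 at *
    generalize betaLaplace (α + i + 1) (β + j - i) x = B2 at *
    generalize betaLaplace (α + i) (β + j - i) x = B3 at *
    field_simp
    linear_combination hrec
  have key := sum_antidiagonal_eq_of_recurrence x (α + β + 2) (by simp; linarith)
    (fun i j => betaLaplace (α + i) (β + j - i) x / Complex.Gamma (α + 1 + i)) hrec m
  have hmul := congrArg (fun z => Complex.Gamma (α + 1 + m) * (y : ℂ) ^ m * z) key
  simp only [Finset.mul_sum] at hmul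
  have hR : Complex.Gamma (α + 1 + m) * (y : ℂ) ^ m * ((-1) ^ m / (m.factorial : ℂ) *
      (betaLaplace (α + m) (β + m - m) x / Complex.Gamma (α + 1 + m))) =
      (-y : ℂ) ^ m / (m.factorial : ℂ) * betaLaplace (α + m) β x := by
    have := hΓ m
    rw [add_sub_cancel_right, neg_pow (y : ℂ)]
    field_simp
  rw [hR] at hmul
  rw [← hmul]
  refine Finset.sum_congr rfl fun p hp => ?_
  obtain ⟨l, n⟩ := p
  have hm : l + n = m := Finset.HasAntidiagonal.mem_antidiagonal.mp hp
  have hG : Complex.Gamma (α + 1 + m) = Complex.Gamma (α + 1 + l) * aP n (α + 1 + l) := by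
    rw [Gamma_mul_aP n (hre l), ← hm]
    push_cast
    ring_nf
  have hΓl := hΓ l
  dsimp only
  rw [hG, ← hm, show (l : ℂ) + (α + β + 2) - 1 = l + (α + β + 1) by ring]
  push_cast
  rw [show β + 2 * (l : ℂ) - l = β + l by ring, pow_add, mul_pow]
  have hcancel := mul_inv_cancel₀ hΓl
  clear hmul hR key hrec hG hΓ hre hΓl hp hm
  generalize Complex.Gamma (α + 1 + l) = G at hcancel ⊢
  generalize betaLaplace (α + l) (β + l) x = J
  generalize aP l (l + (α + β + 1)) = P
  generalize aP n (α + 1 + l) = Q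
  generalize aP n (α + β + 2 + 2 * l) = R
  simp only [div_eq_mul_inv, mul_inv]
  linear_combination (-((-1) ^ l * x ^ l * y ^ l * y ^ n * P⁻¹ * (l.factorial : ℂ)⁻¹ * R⁻¹ *
    (n.factorial : ℂ)⁻¹ * Q * J)) * hcancel

/-- The addition theorem in terms of `betaLaplace`. -/
theorem hasSum_betaLaplace_addition {α β : ℂ} {x y : ℝ} (hα : -1 < α.re)
    (hc : 0 < (α + β + 1).re) (hy : 0 < y) (hxy : y < x) :
    HasSum (fun l : ℕ => (-1) ^ l * (((x * y : ℝ) : ℂ) ^ l /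
        (aP l (l + (α + β + 1)) * (l.factorial : ℂ)) * betaLaplace (α + l) (β + l) x) *
        ∑' n : ℕ, aP n (α + 1 + l) / (aP n (α + β + 2 + 2 * l) * (n.factorial : ℂ)) * (y : ℂ) ^ n)
      (betaLaplace α β (x + y)) := by
  have hc' : 0 < α.re + β.re + 1 := by simpa using hc
  have hdiag := sum_antidiagonal_betaLaplace y hα hc' (hy.trans hxy)
  have hg := summable_norm_betaLaplace_coeff hα hc hy hxy
  have hqle := norm_aP_div_mul_pow_le (a := α + 1) (b := α + β + 2) (by simp; linarith) hy
  generalize hgdef : (fun l : ℕ => ((x * y : ℝ) : ℂ) ^ l /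
    (aP l (l + (α + β + 1)) * (l.factorial : ℂ)) * betaLaplace (α + l) (β + l) x) = g
  generalize hqdef : (fun l n : ℕ =>
    aP n (α + 1 + l) / (aP n (α + β + 2 + 2 * l) * (n.factorial : ℂ)) * (y : ℂ) ^ n) = q
  simp only [funext_iff] at hgdef hqdef
  simp only [hgdef, hqdef] at hdiag hg hqle ⊢
  have hQ : Summable fun n : ℕ => ((‖α + 1‖ + 1) * y) ^ n / (n.factorial : ℝ) :=
    Real.summable_pow_div_factorial _
  have hf : Summable fun p : ℕ × ℕ => (-1) ^ p.1 * g p.1 * q p.1 p.2 := by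
    refine Summable.of_norm_bounded
      (hg.mul_of_nonneg hQ (fun _ => norm_nonneg _) (fun n => by positivity)) fun p => ?_
    rw [norm_mul, norm_mul, norm_pow, norm_neg, norm_one, one_pow, one_mul]
    exact mul_le_mul_of_nonneg_left (hqle _ _) (norm_nonneg _)
  have hrow := hf.hasSum.prod_fiberwise fun l =>
    (Summable.of_norm_bounded hQ (hqle l)).hasSum.mul_left ((-1) ^ l * g l)
  have hsigma := (((Finset.HasAntidiagonal.sigmaAntidiagonalEquivProd (A := ℕ)).hasSum_iff).mpr
    hf.hasSum).sigma fun m => hasSum_fintype _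
  have hcauchy : HasSum (fun m : ℕ => (-y : ℂ) ^ m / (m.factorial : ℂ) * betaLaplace (α + m) β x)
      (∑' p : ℕ × ℕ, (-1) ^ p.1 * g p.1 * q p.1 p.2) := by
    refine hsigma.congr_fun fun m => ?_
    rw [← hdiag m, ← Finset.sum_coe_sort]
    rfl
  rwa [hcauchy.unique (hasSum_betaLaplace_add β hα hy hxy)] at hrow

lemma whittakerW_eq_betaLaplace (κ ν : ℂ) {r : ℝ} (hr : 0 < r) :
    whittakerW κ ν r = Complex.exp (-(r : ℂ) / 2) * (r : ℂ) ^ (ν + 1 / 2) *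
      (Complex.Gamma (ν - κ + 1 / 2))⁻¹ * betaLaplace (ν - κ - 1 / 2) (ν + κ - 1 / 2) r := by
  have hr0 : (r : ℂ) ≠ 0 := by exact_mod_cast hr.ne'
  have hsub := integral_comp_mul_left_Ioi' (fun t : ℝ => (t : ℂ) ^ (ν - κ - 1 / 2) *
    ((1 + t / r : ℝ) : ℂ) ^ (ν + κ - 1 / 2) * Complex.exp (-(t : ℂ))) 0 hr
  rw [mul_zero] at hsub
  have hcongr : ∫ s in Set.Ioi (0 : ℝ), ((r * s : ℝ) : ℂ) ^ (ν - κ - 1 / 2) *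
      ((1 + r * s / r : ℝ) : ℂ) ^ (ν + κ - 1 / 2) * Complex.exp (-((r * s : ℝ) : ℂ)) =
      (r : ℂ) ^ (ν - κ - 1 / 2) * betaLaplace (ν - κ - 1 / 2) (ν + κ - 1 / 2) r := by
    rw [betaLaplace, ← integral_const_mul]
    refine setIntegral_congr_fun measurableSet_Ioi fun s (hs : 0 < s) => ?_
    simp only [betaLaplaceKernel]
    rw [mul_div_cancel_left₀ _ hr.ne', Complex.ofReal_mul,
      Complex.mul_cpow_ofReal_nonneg hr.le hs.le]
    push_cast
    ring
  rw [whittakerW, ← hsub, hcongr, show ν + 1 / 2 = κ + (ν - κ - 1 / 2) + 1 by ring,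
    Complex.cpow_add _ _ hr0, Complex.cpow_add _ _ hr0, Complex.cpow_one, Complex.real_smul]
  ring

/-- A generalization of the `γ = π` addition formula for the Whittaker functions. -/
theorem whittaker_addition_gamma_pi_general (r₀ r : ℝ) (hr₀ : 0 < r₀) (hr : r₀ < r)
    (κ μ : ℂ) (hμ : 0 < μ.re) (h1 : 0 < (μ - κ + 1 / 2).re) :
    HasSum
      (fun ℓ : ℕ =>
        (1 / ((r * r₀ : ℝ) : ℂ) ^ (μ + 1 / 2)) * (-1) ^ ℓ *
          (aP ℓ (μ - κ + 1 / 2) / (aP ℓ ((ℓ : ℂ) + 2 * μ) * (ℓ.factorial : ℂ))) *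
          whittakerM κ ((ℓ : ℂ) + μ) r₀ * whittakerW κ ((ℓ : ℂ) + μ) r)
      (((r + r₀ : ℝ) : ℂ) ^ (-μ - 1 / 2) * whittakerW κ μ (r + r₀)) := by
  have hrpos : 0 < r := hr₀.trans hr
  have hrC : (r : ℂ) ≠ 0 := by exact_mod_cast hrpos.ne'
  have hr₀C : (r₀ : ℂ) ≠ 0 := by exact_mod_cast hr₀.ne'
  have hsC : ((r + r₀ : ℝ) : ℂ) ≠ 0 := by exact_mod_cast (add_pos hrpos hr₀).ne'
  have hα : -1 < (μ - κ - 1 / 2).re := by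
    rw [show μ - κ - 1 / 2 = μ - κ + 1 / 2 - 1 by ring, Complex.sub_re, Complex.one_re]
    linarith
  have hc : 0 < (μ - κ - 1 / 2 + (μ + κ - 1 / 2) + 1).re := by
    rw [show μ - κ - 1 / 2 + (μ + κ - 1 / 2) + 1 = 2 * μ by ring]
    simpa using hμ
  have key := (hasSum_betaLaplace_addition hα hc hr₀ hr).mul_left
    (Complex.exp (-((r + r₀ : ℝ) : ℂ) / 2) * (Complex.Gamma (μ - κ + 1 / 2))⁻¹)
  have hsum : ((r + r₀ : ℝ) : ℂ) ^ (-μ - 1 / 2) * whittakerW κ μ (r + r₀) =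
      Complex.exp (-((r + r₀ : ℝ) : ℂ) / 2) * (Complex.Gamma (μ - κ + 1 / 2))⁻¹ *
        betaLaplace (μ - κ - 1 / 2) (μ + κ - 1 / 2) (r + r₀) := by
    rw [whittakerW_eq_betaLaplace κ μ (add_pos hrpos hr₀),
      show -μ - 1 / 2 = -(μ + 1 / 2) by ring, Complex.cpow_neg]
    have : ((r + r₀ : ℝ) : ℂ) ^ (μ + 1 / 2) ≠ 0 :=
      fun h => hsC ((Complex.cpow_eq_zero_iff _ _).mp h).1
    generalize ((r + r₀ : ℝ) : ℂ) ^ (μ + 1 / 2) = p at *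
    field_simp
  rw [hsum]
  refine key.congr_fun fun ℓ => ?_
  have hΓ : Complex.Gamma (μ - κ + 1 / 2) ≠ 0 := Complex.Gamma_ne_zero_of_re_pos h1
  have haP : aP ℓ (μ - κ + 1 / 2) ≠ 0 := aP_ne_zero ℓ h1
  have hpr : (r : ℂ) ^ (μ + 1 / 2) ≠ 0 :=
    fun h => hrC ((Complex.cpow_eq_zero_iff _ _).mp h).1
  have hpr₀ : (r₀ : ℂ) ^ (μ + 1 / 2) ≠ 0 :=
    fun h => hr₀C ((Complex.cpow_eq_zero_iff _ _).mp h).1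
  rw [whittakerW_eq_betaLaplace κ _ hrpos, whittakerM,
    show (ℓ : ℂ) + μ - κ + 1 / 2 = μ - κ + 1 / 2 + ℓ by ring, ← Gamma_mul_aP ℓ h1,
    show (ℓ : ℂ) + μ + 1 / 2 = μ + 1 / 2 + ℓ by ring, Complex.cpow_add _ _ hrC,
    Complex.cpow_add _ _ hr₀C, Complex.cpow_natCast, Complex.cpow_natCast,
    show (ℓ : ℂ) + μ - κ - 1 / 2 = μ - κ - 1 / 2 + ℓ by ring,
    show (ℓ : ℂ) + μ + κ - 1 / 2 = μ + κ - 1 / 2 + ℓ by ring,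
    show 2 * ((ℓ : ℂ) + μ) + 1 = μ - κ - 1 / 2 + (μ + κ - 1 / 2) + 2 + 2 * ℓ by ring,
    show μ - κ - 1 / 2 + (μ + κ - 1 / 2) + 1 = 2 * μ by ring,
    show μ - κ - 1 / 2 + 1 + (ℓ : ℂ) = μ - κ + 1 / 2 + ℓ by ring,
    Complex.ofReal_mul r r₀, Complex.mul_cpow_ofReal_nonneg hrpos.le hr₀.le,
    show -((r + r₀ : ℝ) : ℂ) / 2 = -(r : ℂ) / 2 + -(r₀ : ℂ) / 2 by push_cast; ring,
    Complex.exp_add, mul_pow]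
  generalize (r : ℂ) ^ (μ + 1 / 2) = p at *
  generalize (r₀ : ℂ) ^ (μ + 1 / 2) = p₀ at *
  generalize Complex.Gamma (μ - κ + 1 / 2) = G at *
  generalize aP ℓ (μ - κ + 1 / 2) = A at *
  generalize aP ℓ (ℓ + 2 * μ) = B at *
  generalize (∑' n : ℕ, _ : ℂ) = S
  generalize betaLaplace _ _ r = J
  field_simp
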